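/- (Corollary 2, incremental pruning) Let a = ⟨c_s, c_{a_1},…,c_{a_k}⟩ and b = ⟨c_s, c_{b_1},…,c_{b_k}⟩ (k ≥ 1) be two point sequences with the same source point c_s such that the list c_{b_1},…,c_{b_k} is a permutation of the list c_{a_1},…,c_{a_k}, with pick-up probabilities P, distances D, and constant D∞. Assume F1(a) < F1(b). Then for every starting point c_0 and every prefix c_1,…,c_m (m ≥ 0) such that P(c_i) < 1 for 1 ≤ i ≤ m and P(c_s) < 1, the routes d_a = ⟨c_0, c_1,…,c_m, c_s, c_{a_1},…,c_{a_k}⟩ and d_b = ⟨c_0, c_1,…,c_m, c_s, c_{b_1},…,c_{b_k}⟩ satisfy F(d_a) < F(d_b); in particular, no driving route having the postfix sequence b can have minimal potential travel distance. -/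

import Mathlib

/-- The probability summation function `PE(p_1,…,p_L) = Σ_{k=1}^{L} (∏_{i=1}^{k−1}(1−p_i))·p_k`
(written with 0-based indices: `p 0, …, p (L-1)`); the empty product equals 1. -/
noncomputable def PE (L : ℕ) (p : ℕ → ℝ) : ℝ :=
  ∑ k ∈ Finset.range L, (∏ i ∈ Finset.range k, (1 - p i)) * p k

/-- The PTD sub-function of a sequence of points `c_1,…,c_L` (0-based: `c 0,…,c (L-1)`):
`F1(c_1,…,c_L) = Σ_{k=2}^{L} (Σ_{i=2}^{k} D_{c_{i−1},c_i})·(∏_{i=2}^{k−1}(1−P(c_i)))·P(c_k)`,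
with `F1(c_1) = 0` when `L = 1`. -/
noncomputable def F1seq {α : Type*} (L : ℕ) (c : ℕ → α) (P : α → ℝ) (D : α → α → ℝ) : ℝ :=
  ∑ k ∈ Finset.Ico 1 L,
    (∑ i ∈ Finset.Icc 1 k, D (c (i - 1)) (c i)) *
      ((∏ i ∈ Finset.Ico 1 k, (1 - P (c i))) * P (c k))

/-- The potential travel distance of a driving route `d = ⟨c_0, c_1,…,c_L⟩` (here `c i` is
the `i`-th point of the route, `c 0` the starting position):
`F(d) = Σ_{k=1}^{L} (Σ_{i=1}^{k} D_{c_{i−1},c_i})·(∏_{i=1}^{k−1}(1−P(c_i)))·P(c_k)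
        + D∞·∏_{i=1}^{L}(1−P(c_i))`. -/
noncomputable def Froute {α : Type*} (L : ℕ) (c : ℕ → α) (P : α → ℝ) (D : α → α → ℝ)
    (Dinf : ℝ) : ℝ :=
  (∑ k ∈ Finset.Icc 1 L,
    (∑ i ∈ Finset.Icc 1 k, D (c (i - 1)) (c i)) *
      ((∏ i ∈ Finset.Ico 1 k, (1 - P (c i))) * P (c k))) +
    Dinf * ∏ i ∈ Finset.Icc 1 L, (1 - P (c i))

/-- The route PTD sub-function of a route `⟨c_0, c_1,…,c_m⟩`:
`F1(⟨c_0,…,c_m⟩) = Σ_{k=1}^{m} (Σ_{i=1}^{k} D_{c_{i−1},c_i})·(∏_{i=1}^{k−1}(1−P(c_i)))·P(c_k)`,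
which equals 0 when `m = 0`. -/
noncomputable def F1route {α : Type*} (m : ℕ) (c : ℕ → α) (P : α → ℝ) (D : α → α → ℝ) : ℝ :=
  ∑ k ∈ Finset.Icc 1 m,
    (∑ i ∈ Finset.Icc 1 k, D (c (i - 1)) (c i)) *
      ((∏ i ∈ Finset.Ico 1 k, (1 - P (c i))) * P (c k))

/-- The sequence `⟨c_s, t_1, t_2, …⟩` (0-based: index 0 is `cs`, index `i ≥ 1` is `t (i-1)`). -/
def seqPts {α : Type*} (cs : α) (t : ℕ → α) : ℕ → α :=
  fun i => if i = 0 then cs else t (i - 1)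

/-- The route `⟨c_0, c_1,…,c_m, c_s, t_1,…⟩`: index 0 is the starting point `c0`, indices
`1,…,m` are the prefix points `pre 0,…,pre (m-1)`, index `m+1` is `cs`, and index `m+1+j`
(`j ≥ 1`) is `t (j-1)`. -/
def routePts {α : Type*} (c0 : α) (m : ℕ) (pre : ℕ → α) (cs : α) (t : ℕ → α) : ℕ → α :=
  fun i => if i = 0 then c0 else if i ≤ m then pre (i - 1)
    else if i = m + 1 then cs else t (i - m - 2)

/-- A product over `1, …, n + L` splits into the first `n` factors and the shifted remainder. -/
@[to_additive]
theorem prod_Icc_add {M : Type*} [CommMonoid M] (f : ℕ → M) (n L : ℕ) :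
    ∏ i ∈ Finset.Icc 1 (n + L), f i =
      (∏ i ∈ Finset.Icc 1 n, f i) * ∏ i ∈ Finset.Icc 1 L, f (n + i) := by
  induction L with
  | zero => simp
  | succ L ih =>
    rw [← add_assoc, Finset.prod_Icc_succ_top (by lia), ih, Finset.prod_Icc_succ_top (by lia),
      mul_assoc, add_assoc]

theorem routeLength_add {α : Type*} (D : α → α → ℝ) (c : ℕ → α) (n L : ℕ) :
    ∑ i ∈ Finset.Icc 1 (n + L), D (c (i - 1)) (c i) =
      (∑ i ∈ Finset.Icc 1 n, D (c (i - 1)) (c i)) +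
        ∑ i ∈ Finset.Icc 1 L, D (c (n + (i - 1))) (c (n + i)) := by
  rw [sum_Icc_add]
  congr 1
  refine Finset.sum_congr rfl fun i hi => ?_
  rw [Nat.add_sub_assoc (Finset.mem_Icc.1 hi).1]

theorem F1route_succ {α : Type*} (c : ℕ → α) (P : α → ℝ) (D : α → α → ℝ) (L : ℕ) :
    F1route (L + 1) c P D = F1route L c P D +
      (∑ i ∈ Finset.Icc 1 (L + 1), D (c (i - 1)) (c i)) *
        ((∏ i ∈ Finset.Icc 1 L, (1 - P (c i))) * P (c (L + 1))) := by
  rw [F1route, Finset.sum_Icc_succ_top (by lia), Finset.Ico_add_one_right_eq_Icc, F1route]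

/-- Decomposition of the route PTD sub-function into a prefix of length `n` and the remaining
sequence, weighted by the probability that no pick-up happens along the prefix. -/
theorem F1route_add {α : Type*} (c : ℕ → α) (P : α → ℝ) (D : α → α → ℝ) (n L : ℕ) :
    F1route (n + L) c P D = F1route n c P D + (∏ i ∈ Finset.Icc 1 n, (1 - P (c i))) *
      ((∑ i ∈ Finset.Icc 1 n, D (c (i - 1)) (c i)) *
          (1 - ∏ i ∈ Finset.Icc 1 L, (1 - P (c (n + i)))) +
        F1route L (fun i => c (n + i)) P D) := by
  induction L with
  | zero => simp [F1route]
  | succ L ih =>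
    rw [← add_assoc, F1route_succ, ih, F1route_succ, add_assoc n L 1, routeLength_add,
      prod_Icc_add, Finset.prod_Icc_succ_top (b := L) (by lia)]
    ring

theorem F1seq_succ {α : Type*} (c : ℕ → α) (P : α → ℝ) (D : α → α → ℝ) (L : ℕ) :
    F1seq (L + 1) c P D = F1route L c P D := by
  rw [F1seq, F1route, Finset.Ico_add_one_right_eq_Icc]

theorem F1route_congr {α : Type*} {c c' : ℕ → α} (P : α → ℝ) (D : α → α → ℝ) {L : ℕ}
    (h : ∀ i ≤ L, c i = c' i) : F1route L c P D = F1route L c' P D := by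
  refine Finset.sum_congr rfl fun k hk => ?_
  have hkL := (Finset.mem_Icc.1 hk).2
  congr 1
  · refine Finset.sum_congr rfl fun i hi => ?_
    have hik := (Finset.mem_Icc.1 hi).2
    rw [h i (by lia), h (i - 1) (by lia)]
  · rw [h k hkL]
    congr 1
    refine Finset.prod_congr rfl fun i hi => ?_
    rw [h i ((Finset.mem_Ico.1 hi).2.le.trans hkL)]

/-- Decomposition of the potential travel distance of a route into a prefix of length `n` and the
remaining sequence. -/
theorem Froute_add {α : Type*} (c : ℕ → α) (P : α → ℝ) (D : α → α → ℝ) (Dinf : ℝ) (n L : ℕ) :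
    Froute (n + L) c P D Dinf = F1route n c P D + (∏ i ∈ Finset.Icc 1 n, (1 - P (c i))) *
      ((∑ i ∈ Finset.Icc 1 n, D (c (i - 1)) (c i)) *
          (1 - ∏ i ∈ Finset.Icc 1 L, (1 - P (c (n + i)))) +
        F1route L (fun i => c (n + i)) P D +
        Dinf * ∏ i ∈ Finset.Icc 1 L, (1 - P (c (n + i)))) := by
  change F1route (n + L) c P D + _ = _
  rw [F1route_add, prod_Icc_add]
  ring

theorem routePts_add {α : Type*} (c0 : α) (m : ℕ) (pre : ℕ → α) (cs : α) (t : ℕ → α) (i : ℕ) :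
    routePts c0 m pre cs t (m + 1 + i) = seqPts cs t i := by
  unfold routePts seqPts
  rcases i with _ | i
  · simp
  · rw [if_neg (by lia), if_neg (by lia), if_neg (by lia), if_neg (by lia)]
    congr 1
    lia

theorem routePts_prefix_eq {α : Type*} (c0 : α) (m : ℕ) (pre : ℕ → α) (cs : α) (t t' : ℕ → α)
    {i : ℕ} (hi : i ≤ m + 1) : routePts c0 m pre cs t i = routePts c0 m pre cs t' i := by
  unfold routePts
  split_ifs <;> first | rfl | lia

theorem prod_seqPts {α M : Type*} [CommMonoid M] (g : α → M) (cs : α) (t : ℕ → α) (k : ℕ) :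
    ∏ i ∈ Finset.Icc 1 k, g (seqPts cs t i) =
      ((List.ofFn fun i : Fin k => t i).map g).prod := by
  rw [List.map_ofFn, List.prod_ofFn]
  simp only [Function.comp_apply]
  rw [Fin.prod_univ_eq_prod_range (fun i => g (t i)), ← Finset.Ico_add_one_right_eq_Icc,
    Finset.prod_Ico_eq_prod_range]
  simp [seqPts, add_comm]

theorem prod_one_sub_routePts_pos {α : Type*} {P : α → ℝ} (c0 : α) {m : ℕ} {pre : ℕ → α} {cs : α}
    (t : ℕ → α) (hpre : ∀ i < m, P (pre i) < 1) (hcs : P cs < 1) :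
    0 < ∏ i ∈ Finset.Icc 1 (m + 1), (1 - P (routePts c0 m pre cs t i)) := by
  refine Finset.prod_pos fun i hi => sub_pos.2 ?_
  obtain ⟨h1, h2⟩ := Finset.mem_Icc.1 hi
  unfold routePts
  rw [if_neg (by lia)]
  split_ifs
  · exact hpre _ (by lia)
  · exact hcs
  · lia

/-- Corollary 2, incremental pruning: let `a = ⟨c_s, c_{a_1},…,c_{a_k}⟩` and
`b = ⟨c_s, c_{b_1},…,c_{b_k}⟩` (`k ≥ 1`) share the source point `c_s`, where the list
`c_{b_1},…,c_{b_k}` is a permutation of `c_{a_1},…,c_{a_k}`, and assume `F1(a) < F1(b)`.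
Then for every starting point `c_0` and every prefix `c_1,…,c_m` (`m ≥ 0`) with
`P(c_i) < 1` for `1 ≤ i ≤ m` and `P(c_s) < 1`, the routes
`d_a = ⟨c_0, c_1,…,c_m, c_s, c_{a_1},…,c_{a_k}⟩` and
`d_b = ⟨c_0, c_1,…,c_m, c_s, c_{b_1},…,c_{b_k}⟩` satisfy `F(d_a) < F(d_b)`
(so no driving route having the postfix sequence `b` can be optimal). -/
theorem incremental_pruning {α : Type*} (k : ℕ) (hk : 1 ≤ k) (cs : α) (ta tb : ℕ → α)
    (P : α → ℝ) (D : α → α → ℝ) (Dinf : ℝ)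
    (hperm : (List.ofFn fun i : Fin k => tb i).Perm (List.ofFn fun i : Fin k => ta i))
    (hcs : P cs < 1)
    (hF1 : F1seq (k + 1) (seqPts cs ta) P D < F1seq (k + 1) (seqPts cs tb) P D) :
    ∀ (c0 : α) (m : ℕ) (pre : ℕ → α), (∀ i < m, P (pre i) < 1) →
      Froute (m + 1 + k) (routePts c0 m pre cs ta) P D Dinf <
        Froute (m + 1 + k) (routePts c0 m pre cs tb) P D Dinf := by
  intro c0 m pre hpre
  have hpos := prod_one_sub_routePts_pos c0 tb hpre hcs
  have heq : ∀ i ≤ m + 1, routePts c0 m pre cs ta i = routePts c0 m pre cs tb i :=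
    fun i hi => routePts_prefix_eq c0 m pre cs ta tb hi
  have hprod : ∏ i ∈ Finset.Icc 1 (m + 1), (1 - P (routePts c0 m pre cs ta i)) =
      ∏ i ∈ Finset.Icc 1 (m + 1), (1 - P (routePts c0 m pre cs tb i)) :=
    Finset.prod_congr rfl fun i hi => by rw [heq i (Finset.mem_Icc.1 hi).2]
  have hsum : ∑ i ∈ Finset.Icc 1 (m + 1),
        D (routePts c0 m pre cs ta (i - 1)) (routePts c0 m pre cs ta i) =
      ∑ i ∈ Finset.Icc 1 (m + 1),
        D (routePts c0 m pre cs tb (i - 1)) (routePts c0 m pre cs tb i) :=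
    Finset.sum_congr rfl fun i hi => by
      have hi' := (Finset.mem_Icc.1 hi).2
      rw [heq i hi', heq (i - 1) (by lia)]
  have hperm' : ∏ i ∈ Finset.Icc 1 k, (1 - P (seqPts cs ta i)) =
      ∏ i ∈ Finset.Icc 1 k, (1 - P (seqPts cs tb i)) := by
    rw [prod_seqPts (fun x => 1 - P x), prod_seqPts (fun x => 1 - P x)]
    exact ((hperm.map _).prod_eq).symm
  rw [F1seq_succ, F1seq_succ] at hF1
  rw [Froute_add, Froute_add, F1route_congr P D heq, hprod, hsum]
  simp only [routePts_add]
  rw [hperm']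
  gcongr
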